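/- arXiv:2011.10648 — 4 statements merged into one kernel-verified Lean document; each statement's English description precedes it below -/
import Mathlib

section
/- (Block structure of the Galerkin reduced space–time system matrix.) Assume Φ_s ∈ ℝ^{N_s × n_s} has orthonormal columns, i.e., Φ_sᵀ Φ_s = I_{n_s}. Then the (j′, j) block (of size n_s × n_s) of the Galerkin reduced matrix Φ_stᵀ A^st Φ_st equals Σ_{k=1}^{N_t} ( D_k^{j′} D_k^{j} − Δt^{(k)} D_k^{j′} Φ_sᵀ A Φ_s D_k^{j} ) − Σ_{k=1}^{N_t−1} D_{k+1}^{j′} D_k^{j}. -/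
open Matrix

/-- The block lower bidiagonal space–time system matrix `A^st`. -/
def spaceTimeMat (Ns Nt : ℕ) (A : Matrix (Fin Ns) (Fin Ns) ℝ) (Δt : Fin Nt → ℝ) :
    Matrix (Fin Nt × Fin Ns) (Fin Nt × Fin Ns) ℝ :=
  Matrix.of fun p q =>
    if p.1 = q.1 then ((1 : Matrix (Fin Ns) (Fin Ns) ℝ) - Δt q.1 • A) p.2 q.2
    else if (p.1 : ℕ) = (q.1 : ℕ) + 1 then -((1 : Matrix (Fin Ns) (Fin Ns) ℝ) p.2 q.2)
    else 0

/-- `D_k^j`: diagonal matrix whose `i`-th diagonal entry is the `k`-th component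
of the temporal basis vector `φᵗ_{ij}`. -/
def Dmat (Ns Nt ns nt : ℕ) (φt : Fin ns → Fin nt → Fin Nt → ℝ) (k : Fin Nt)
    (j : Fin nt) : Matrix (Fin ns) (Fin ns) ℝ :=
  Matrix.diagonal fun i => φt i j k

/-- The space–time basis matrix `Φ_st`, whose `(k, j)` block is `Φ_s D_k^j`. -/
def Phist (Ns Nt ns nt : ℕ) (Φs : Matrix (Fin Ns) (Fin ns) ℝ)
    (φt : Fin ns → Fin nt → Fin Nt → ℝ) :
    Matrix (Fin Nt × Fin Ns) (Fin nt × Fin ns) ℝ :=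
  Matrix.of fun p q => (Φs * Dmat Ns Nt ns nt φt p.1 q.1) p.2 q.2

/-- The block of a triple product of block matrices is the double sum of the products of blocks. -/
theorem block_mul_mul {R κ κ' μ ν σ τ : Type*} [NonUnitalSemiring R] [Fintype κ] [Fintype σ]
    [Fintype κ'] [Fintype τ] (X : Matrix μ (κ × σ) R) (S : Matrix (κ × σ) (κ' × τ) R)
    (Y : Matrix (κ' × τ) ν R) :
    X * S * Y = ∑ l, ∑ k, (Matrix.of fun i a => X i (k, a)) *
      (Matrix.of fun a b => S (k, a) (l, b)) * (Matrix.of fun b i => Y (l, b) i) := by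
  ext i i'
  simp only [Matrix.sum_apply, Matrix.mul_apply, Matrix.of_apply, Fintype.sum_prod_type,
    Finset.sum_mul]
  refine Finset.sum_congr rfl fun l _ => ?_
  rw [Finset.sum_comm]

theorem spaceTimeMat_block (Ns Nt : ℕ) (A : Matrix (Fin Ns) (Fin Ns) ℝ) (Δt : Fin Nt → ℝ)
    (k l : Fin Nt) :
    (Matrix.of fun a b => spaceTimeMat Ns Nt A Δt (k, a) (l, b)) =
      (if k = l then 1 - Δt l • A else 0) - if (k : ℕ) = (l : ℕ) + 1 then 1 else 0 := by
  ext a b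
  by_cases h : k = l
  · subst h
    simp [spaceTimeMat]
  · by_cases h' : (k : ℕ) = (l : ℕ) + 1 <;> simp [spaceTimeMat, h, h']

theorem Fin.sum_ite_val_eq_succ {M : Type*} [AddCommMonoid M] {n : ℕ} (l : Fin n)
    (f : Fin n → M) :
    (∑ k : Fin n, if (k : ℕ) = (l : ℕ) + 1 then f k else 0) =
      if h : (l : ℕ) + 1 < n then f ⟨(l : ℕ) + 1, h⟩ else 0 := by
  split_ifs with h
  · rw [Finset.sum_eq_single ⟨(l : ℕ) + 1, h⟩]
    · simp
    · intro k _ hk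
      exact if_neg fun e => hk (Fin.ext e)
    · simp
  · refine Finset.sum_eq_zero fun k _ => if_neg ?_
    have := k.isLt
    omega

/-- Block structure of the Galerkin reduced space–time system matrix: if `Φ_s`
has orthonormal columns, the `(j', j)` block of `Φ_stᵀ A^st Φ_st` equals
`Σ_{k=1}^{N_t} (D_k^{j'} D_k^j − Δt^{(k)} D_k^{j'} Φ_sᵀ A Φ_s D_k^j)
 − Σ_{k=1}^{N_t−1} D_{k+1}^{j'} D_k^j`. -/
theorem galerkin_reduced_matrix_block (Ns Nt ns nt : ℕ)
    (A : Matrix (Fin Ns) (Fin Ns) ℝ) (Δt : Fin Nt → ℝ)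
    (Φs : Matrix (Fin Ns) (Fin ns) ℝ) (hΦs : Φsᵀ * Φs = 1)
    (φt : Fin ns → Fin nt → Fin Nt → ℝ) (j' j : Fin nt) :
    (Matrix.of fun i' i : Fin ns =>
        ((Phist Ns Nt ns nt Φs φt)ᵀ * spaceTimeMat Ns Nt A Δt *
          Phist Ns Nt ns nt Φs φt) (j', i') (j, i)) =
      (∑ k : Fin Nt,
        (Dmat Ns Nt ns nt φt k j' * Dmat Ns Nt ns nt φt k j -
          Δt k • (Dmat Ns Nt ns nt φt k j' * Φsᵀ * A * Φs * Dmat Ns Nt ns nt φt k j))) -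
      ∑ k : Fin Nt,
        if h : (k : ℕ) + 1 < Nt then
          Dmat Ns Nt ns nt φt ⟨(k : ℕ) + 1, h⟩ j' * Dmat Ns Nt ns nt φt k j
        else 0 := by
  have gram (P Q : Matrix (Fin ns) (Fin ns) ℝ) : P * Φsᵀ * (Φs * Q) = P * Q := by
    rw [Matrix.mul_assoc, ← Matrix.mul_assoc Φsᵀ, hΦs, Matrix.one_mul]
  have mul_ite_mul (c : Prop) [Decidable c] (P : Matrix (Fin ns) (Fin Ns) ℝ)
      (B : Matrix (Fin Ns) (Fin Ns) ℝ) (Q : Matrix (Fin Ns) (Fin ns) ℝ) :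
      P * (if c then B else 0) * Q = if c then P * B * Q else 0 := by
    split_ifs <;> simp
  have hX (k : Fin Nt) : (Matrix.of fun i' a =>
      Phist Ns Nt ns nt Φs φt (k, a) (j', i')) = Dmat Ns Nt ns nt φt k j' * Φsᵀ := by
    rw [← (Dmat Ns Nt ns nt φt k j').transpose_transpose, ← Matrix.transpose_mul]
    simp only [Dmat, Matrix.diagonal_transpose]
    rfl
  have hY (l : Fin Nt) : (Matrix.of fun b i =>
      Phist Ns Nt ns nt Φs φt (l, b) (j, i)) = Φs * Dmat Ns Nt ns nt φt l j := rfl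
  calc
    _ = (Matrix.of fun i' p => Phist Ns Nt ns nt Φs φt p (j', i')) * spaceTimeMat Ns Nt A Δt *
          (Matrix.of fun p i => Phist Ns Nt ns nt Φs φt p (j, i)) := rfl
    _ = _ := by
      rw [block_mul_mul, ← Finset.sum_sub_distrib]
      refine Finset.sum_congr rfl fun l _ => ?_
      simp only [Matrix.of_apply, hX, hY, spaceTimeMat_block, Matrix.mul_sub, Matrix.sub_mul,
        Finset.sum_sub_distrib, mul_ite_mul, Matrix.mul_one, Finset.sum_ite_eq', Finset.mem_univ,
        if_true, gram, Fin.sum_ite_val_eq_succ, Matrix.mul_smul, Matrix.smul_mul]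
      simp only [Matrix.mul_assoc]
end

section
/- (Block structure of the Petrov–Galerkin reduced space–time system matrix.) Assume Φ_s ∈ ℝ^{N_s × n_s} has orthonormal columns, i.e., Φ_sᵀ Φ_s = I_{n_s}. Then the (j, j′) block (of size n_s × n_s) of the least-squares Petrov–Galerkin reduced matrix Φ_stᵀ (A^st)ᵀ A^st Φ_st equals Σ_{k=1}^{N_t} D_k^{j′} Φ_sᵀ (I_{N_s} − Δt^{(k)} Aᵀ)(I_{N_s} − Δt^{(k)} A) Φ_s D_k^{j} + Σ_{k=1}^{N_t−1} [ D_k^{j′} D_k^{j} − D_k^{j′} Φ_sᵀ (I_{N_s} − Δt^{(k+1)} A) Φ_s D_{k+1}^{j} − D_{k+1}^{j′} Φ_sᵀ (I_{N_s} − Δt^{(k+1)} Aᵀ) Φ_s D_k^{j} ]. -/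
open Matrix

/-- The `(k, l)` block of the space–time system matrix. -/
def spaceTimeBlock {Ns Nt : ℕ} (A : Matrix (Fin Ns) (Fin Ns) ℝ) (Δt : Fin Nt → ℝ)
    (k l : Fin Nt) : Matrix (Fin Ns) (Fin Ns) ℝ :=
  Matrix.of fun s t => spaceTimeMat Ns Nt A Δt (k, s) (l, t)

theorem spaceTimeBlock_zero {Ns m : ℕ} (A : Matrix (Fin Ns) (Fin Ns) ℝ)
    (Δt : Fin (m + 1) → ℝ) (l : Fin (m + 1)) :
    spaceTimeBlock A Δt 0 l = if l = 0 then 1 - Δt 0 • A else 0 := by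
  ext s t
  by_cases h : l = 0
  · subst h
    simp [spaceTimeBlock, spaceTimeMat]
  · simp [spaceTimeBlock, spaceTimeMat, h, Ne.symm h]

theorem spaceTimeBlock_succ {Ns m : ℕ} (A : Matrix (Fin Ns) (Fin Ns) ℝ)
    (Δt : Fin (m + 1) → ℝ) (k : Fin m) (l : Fin (m + 1)) :
    spaceTimeBlock A Δt k.succ l =
      (if l = k.succ then 1 - Δt k.succ • A else 0) - if l = k.castSucc then 1 else 0 := by
  ext s t
  by_cases h : l = k.succ
  · subst h
    have hc : k.succ ≠ k.castSucc := by simp [Fin.ext_iff]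
    simp [spaceTimeBlock, spaceTimeMat, hc]
  · by_cases hc : l = k.castSucc
    · subst hc
      simp [spaceTimeBlock, spaceTimeMat, h, Ne.symm h]
    · have hne : ¬ (k : ℕ) = l := fun e => hc (Fin.ext e.symm)
      simp [spaceTimeBlock, spaceTimeMat, h, Ne.symm h, hc, hne]

/-- The `(k, j)` block of the product `A^st Φ_st`. -/
def systemBasisBlock {Ns Nt ns nt : ℕ} (A : Matrix (Fin Ns) (Fin Ns) ℝ) (Δt : Fin Nt → ℝ)
    (Φs : Matrix (Fin Ns) (Fin ns) ℝ) (φt : Fin ns → Fin nt → Fin Nt → ℝ)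
    (k : Fin Nt) (j : Fin nt) : Matrix (Fin Ns) (Fin ns) ℝ :=
  ∑ l, spaceTimeBlock A Δt k l * (Φs * Dmat Ns Nt ns nt φt l j)

theorem spaceTimeMat_mul_Phist_apply {Ns Nt ns nt : ℕ} (A : Matrix (Fin Ns) (Fin Ns) ℝ)
    (Δt : Fin Nt → ℝ) (Φs : Matrix (Fin Ns) (Fin ns) ℝ)
    (φt : Fin ns → Fin nt → Fin Nt → ℝ) (k : Fin Nt) (s : Fin Ns) (j : Fin nt) (i : Fin ns) :
    (spaceTimeMat Ns Nt A Δt * Phist Ns Nt ns nt Φs φt) (k, s) (j, i) =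
      systemBasisBlock A Δt Φs φt k j s i := by
  rw [systemBasisBlock, Matrix.sum_apply, Matrix.mul_apply, Fintype.sum_prod_type]
  refine Finset.sum_congr rfl fun l _ => ?_
  rw [Matrix.mul_apply]
  rfl

theorem systemBasisBlock_zero {Ns m ns nt : ℕ} (A : Matrix (Fin Ns) (Fin Ns) ℝ)
    (Δt : Fin (m + 1) → ℝ) (Φs : Matrix (Fin Ns) (Fin ns) ℝ)
    (φt : Fin ns → Fin nt → Fin (m + 1) → ℝ) (j : Fin nt) :
    systemBasisBlock A Δt Φs φt 0 j =
      (1 - Δt 0 • A) * (Φs * Dmat Ns (m + 1) ns nt φt 0 j) := by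
  simp only [systemBasisBlock, spaceTimeBlock_zero]
  rw [Finset.sum_eq_single 0 (fun l _ h => by simp [h]) (by simp), if_pos rfl]

theorem systemBasisBlock_succ {Ns m ns nt : ℕ} (A : Matrix (Fin Ns) (Fin Ns) ℝ)
    (Δt : Fin (m + 1) → ℝ) (Φs : Matrix (Fin Ns) (Fin ns) ℝ)
    (φt : Fin ns → Fin nt → Fin (m + 1) → ℝ) (k : Fin m) (j : Fin nt) :
    systemBasisBlock A Δt Φs φt k.succ j =
      (1 - Δt k.succ • A) * (Φs * Dmat Ns (m + 1) ns nt φt k.succ j) -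
        Φs * Dmat Ns (m + 1) ns nt φt k.castSucc j := by
  simp only [systemBasisBlock, spaceTimeBlock_succ,
    Matrix.sub_mul (ite _ _ _), Finset.sum_sub_distrib]
  congr 1
  · rw [Finset.sum_eq_single k.succ (fun l _ h => by simp [h]) (by simp), if_pos rfl]
  · rw [Finset.sum_eq_single k.castSucc (fun l _ h => by simp [h]) (by simp), if_pos rfl,
      Matrix.one_mul]

theorem petrovGalerkin_block_eq_sum {Ns Nt ns nt : ℕ} (A : Matrix (Fin Ns) (Fin Ns) ℝ)
    (Δt : Fin Nt → ℝ) (Φs : Matrix (Fin Ns) (Fin ns) ℝ)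
    (φt : Fin ns → Fin nt → Fin Nt → ℝ) (j' j : Fin nt) :
    (Matrix.of fun i' i : Fin ns =>
        ((Phist Ns Nt ns nt Φs φt)ᵀ * (spaceTimeMat Ns Nt A Δt)ᵀ *
          spaceTimeMat Ns Nt A Δt * Phist Ns Nt ns nt Φs φt) (j', i') (j, i)) =
      ∑ k, (systemBasisBlock A Δt Φs φt k j')ᵀ * systemBasisBlock A Δt Φs φt k j := by
  ext i' i
  rw [Matrix.of_apply, ← Matrix.transpose_mul, Matrix.mul_assoc, Matrix.mul_apply,
    Fintype.sum_prod_type, Matrix.sum_apply]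
  simp only [Matrix.mul_apply (M := (systemBasisBlock _ _ _ _ _ _)ᵀ), Matrix.transpose_apply,
    spaceTimeMat_mul_Phist_apply]

theorem Dmat_transpose {Ns Nt ns nt : ℕ} (φt : Fin ns → Fin nt → Fin Nt → ℝ) (k : Fin Nt)
    (j : Fin nt) : (Dmat Ns Nt ns nt φt k j)ᵀ = Dmat Ns Nt ns nt φt k j :=
  Matrix.diagonal_transpose _

/-- Block structure of the least-squares Petrov–Galerkin reduced space–time
system matrix: if `Φ_s` has orthonormal columns, the `(j', j)` block of
`Φ_stᵀ (A^st)ᵀ A^st Φ_st` equals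
`Σ_{k=1}^{N_t} D_k^{j'} Φ_sᵀ (I − Δt^{(k)} Aᵀ)(I − Δt^{(k)} A) Φ_s D_k^j
 + Σ_{k=1}^{N_t−1} [D_k^{j'} D_k^j − D_k^{j'} Φ_sᵀ (I − Δt^{(k+1)} A) Φ_s D_{k+1}^j
 − D_{k+1}^{j'} Φ_sᵀ (I − Δt^{(k+1)} Aᵀ) Φ_s D_k^j]`. -/
theorem petrovGalerkin_reduced_matrix_block (Ns Nt ns nt : ℕ)
    (A : Matrix (Fin Ns) (Fin Ns) ℝ) (Δt : Fin Nt → ℝ)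
    (Φs : Matrix (Fin Ns) (Fin ns) ℝ) (hΦs : Φsᵀ * Φs = 1)
    (φt : Fin ns → Fin nt → Fin Nt → ℝ) (j' j : Fin nt) :
    (Matrix.of fun i' i : Fin ns =>
        ((Phist Ns Nt ns nt Φs φt)ᵀ * (spaceTimeMat Ns Nt A Δt)ᵀ *
          spaceTimeMat Ns Nt A Δt * Phist Ns Nt ns nt Φs φt) (j', i') (j, i)) =
      (∑ k : Fin Nt,
        Dmat Ns Nt ns nt φt k j' * Φsᵀ * (1 - Δt k • Aᵀ) * (1 - Δt k • A) * Φs *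
          Dmat Ns Nt ns nt φt k j) +
      ∑ k : Fin Nt,
        if h : (k : ℕ) + 1 < Nt then
          Dmat Ns Nt ns nt φt k j' * Dmat Ns Nt ns nt φt k j -
            Dmat Ns Nt ns nt φt k j' * Φsᵀ * (1 - Δt ⟨(k : ℕ) + 1, h⟩ • A) * Φs *
              Dmat Ns Nt ns nt φt ⟨(k : ℕ) + 1, h⟩ j -
            Dmat Ns Nt ns nt φt ⟨(k : ℕ) + 1, h⟩ j' * Φsᵀ *
              (1 - Δt ⟨(k : ℕ) + 1, h⟩ • Aᵀ) * Φs * Dmat Ns Nt ns nt φt k j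
        else 0 := by
  rw [petrovGalerkin_block_eq_sum]
  cases Nt with
  | zero => simp
  | succ m =>
    have hΦ : ∀ X : Matrix (Fin ns) (Fin ns) ℝ, Φsᵀ * (Φs * X) = X := fun X => by
      rw [← Matrix.mul_assoc, hΦs, Matrix.one_mul]
    rw [Fin.sum_univ_succ, Fin.sum_univ_succ, Fin.sum_univ_castSucc (n := m), add_assoc]
    congr 1
    · simp only [systemBasisBlock_zero, Matrix.transpose_mul, Matrix.transpose_sub,
        Matrix.transpose_one, Matrix.transpose_smul, Dmat_transpose, Matrix.mul_assoc]
    · rw [dif_neg (by simp), add_zero, ← Finset.sum_add_distrib]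
      refine Finset.sum_congr rfl fun k _ => ?_
      have hk : ((k.castSucc : Fin (m + 1)) : ℕ) + 1 < m + 1 := by simp
      have hs : (⟨((k.castSucc : Fin (m + 1)) : ℕ) + 1, hk⟩ : Fin (m + 1)) = k.succ := rfl
      rw [dif_pos hk, hs, systemBasisBlock_succ, systemBasisBlock_succ]
      have hB : 1 - Δt k.succ • Aᵀ = (1 - Δt k.succ • A)ᵀ := by
        rw [Matrix.transpose_sub, Matrix.transpose_one, Matrix.transpose_smul]
      rw [hB]
      generalize 1 - Δt k.succ • A = B
      simp only [Matrix.transpose_mul, Matrix.transpose_sub, Dmat_transpose, Matrix.sub_mul,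
        Matrix.mul_sub, Matrix.mul_assoc, hΦ]
      abel
end

section
/- (Block structure of the Petrov–Galerkin reduced space–time input vector.) The j-th block (of length n_s) of the least-squares Petrov–Galerkin reduced input vector Φ_stᵀ (A^st)ᵀ f^st equals Σ_{k=1}^{N_t} D_k^{j} Φ_sᵀ (I_{N_s} − Δt^{(k)} Aᵀ) Δt^{(k)} B f^k − Σ_{k=1}^{N_t−1} D_k^{j} Φ_sᵀ Δt^{(k+1)} B f^{k+1}. -/
open Matrix

/-- The space–time input vector `f^st`, whose `k`-th block is `Δt^(k) • B f^k`. -/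
def spaceTimeInput (Ns Nt Ni : ℕ) (B : Matrix (Fin Ns) (Fin Ni) ℝ)
    (Δt : Fin Nt → ℝ) (f : Fin Nt → Fin Ni → ℝ) : Fin Nt × Fin Ns → ℝ :=
  fun p => Δt p.1 * (B.mulVec (f p.1)) p.2

theorem Phist_transpose_mulVec_apply (Ns Nt ns nt : ℕ)
    (Φs : Matrix (Fin Ns) (Fin ns) ℝ) (φt : Fin ns → Fin nt → Fin Nt → ℝ)
    (v : Fin Nt × Fin Ns → ℝ) (j : Fin nt) (i : Fin ns) :
    ((Phist Ns Nt ns nt Φs φt)ᵀ *ᵥ v) (j, i) =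
      ∑ k, (Dmat Ns Nt ns nt φt k j *ᵥ (Φsᵀ *ᵥ fun s => v (k, s))) i := by
  simp only [Dmat, mulVec_diagonal]
  simp only [Phist, Dmat, mulVec, dotProduct, transpose_apply, of_apply, mul_diagonal,
    Fintype.sum_prod_type, Finset.mul_sum]
  refine Finset.sum_congr rfl fun k _ => Finset.sum_congr rfl fun s _ => ?_
  ring

theorem spaceTimeMat_transpose_mulVec_block (Ns Nt : ℕ) (A : Matrix (Fin Ns) (Fin Ns) ℝ)
    (Δt : Fin Nt → ℝ) (w : Fin Nt × Fin Ns → ℝ) (k : Fin Nt) :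
    (fun s => ((spaceTimeMat Ns Nt A Δt)ᵀ *ᵥ w) (k, s)) =
      (1 - Δt k • Aᵀ) *ᵥ (fun s => w (k, s)) -
        if h : (k : ℕ) + 1 < Nt then fun s => w (⟨(k : ℕ) + 1, h⟩, s) else 0 := by
  have hblock (l : Fin Nt) (s : Fin Ns) :
      ∑ r, spaceTimeMat Ns Nt A Δt (l, r) (k, s) * w (l, r) =
        (if l = k then ((1 - Δt k • Aᵀ) *ᵥ fun r => w (l, r)) s else 0) -
          if (l : ℕ) = k + 1 then w (l, s) else 0 := by
    by_cases hl : l = k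
    · subst hl
      simp [spaceTimeMat, mulVec, dotProduct, one_apply, eq_comm]
    · by_cases hk : (l : ℕ) = k + 1 <;> simp [spaceTimeMat, hl, hk, one_apply]
  funext s
  have hsum : ((spaceTimeMat Ns Nt A Δt)ᵀ *ᵥ w) (k, s) =
      ∑ l, ∑ r, spaceTimeMat Ns Nt A Δt (l, r) (k, s) * w (l, r) := by
    simp [mulVec, dotProduct, Fintype.sum_prod_type]
  simp only [hsum, hblock, Finset.sum_sub_distrib, Pi.sub_apply, Finset.sum_ite_eq',
    Finset.mem_univ, if_true]
  congr 1
  split_ifs with h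
  · rw [Finset.sum_eq_single ⟨(k : ℕ) + 1, h⟩]
    · simp
    · intro l _ hl
      exact if_neg fun e => hl (Fin.ext e)
    · simp
  · exact Finset.sum_eq_zero fun l _ => if_neg (by omega)

/-- Block structure of the least-squares Petrov–Galerkin reduced space–time
input vector: the `j`-th block of `Φ_stᵀ (A^st)ᵀ f^st` equals
`Σ_{k=1}^{N_t} D_k^j Φ_sᵀ (I − Δt^{(k)} Aᵀ) Δt^{(k)} B f^k
 − Σ_{k=1}^{N_t−1} D_k^j Φ_sᵀ Δt^{(k+1)} B f^{k+1}`. -/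
theorem petrovGalerkin_reduced_input_block (Ns Nt Ni ns nt : ℕ)
    (A : Matrix (Fin Ns) (Fin Ns) ℝ) (B : Matrix (Fin Ns) (Fin Ni) ℝ)
    (Δt : Fin Nt → ℝ) (f : Fin Nt → Fin Ni → ℝ)
    (Φs : Matrix (Fin Ns) (Fin ns) ℝ) (φt : Fin ns → Fin nt → Fin Nt → ℝ)
    (j : Fin nt) :
    (fun i : Fin ns =>
        (Phist Ns Nt ns nt Φs φt)ᵀ.mulVec
          ((spaceTimeMat Ns Nt A Δt)ᵀ.mulVec (spaceTimeInput Ns Nt Ni B Δt f)) (j, i)) =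
      (∑ k : Fin Nt,
        (Dmat Ns Nt ns nt φt k j).mulVec
          (Φsᵀ.mulVec ((1 - Δt k • Aᵀ).mulVec (Δt k • B.mulVec (f k))))) -
      ∑ k : Fin Nt,
        if h : (k : ℕ) + 1 < Nt then
          (Dmat Ns Nt ns nt φt k j).mulVec
            (Φsᵀ.mulVec (Δt ⟨(k : ℕ) + 1, h⟩ • B.mulVec (f ⟨(k : ℕ) + 1, h⟩)))
        else 0 := by
  funext i
  rw [Phist_transpose_mulVec_apply, Pi.sub_apply, Finset.sum_apply, Finset.sum_apply,
    ← Finset.sum_sub_distrib]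
  refine Finset.sum_congr rfl fun k _ => ?_
  rw [spaceTimeMat_transpose_mulVec_block, mulVec_sub, mulVec_sub, Pi.sub_apply]
  have hinput (l : Fin Nt) :
      (fun s => spaceTimeInput Ns Nt Ni B Δt f (l, s)) = Δt l • B *ᵥ f l := rfl
  simp only [hinput]
  split_ifs <;> simp
end

section
/- (Block structure of the Petrov–Galerkin reduced space–time initial state vector.) The j-th block (of length n_s) of the least-squares Petrov–Galerkin reduced initial state vector Φ_stᵀ (A^st)ᵀ u_0^st equals D_1^{j} Φ_sᵀ (I_{N_s} − Δt^{(1)} Aᵀ) u_0. -/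
open Matrix

/-- The space–time initial vector `u_0^st`, whose first block is `u_0` and all
other blocks are zero. -/
def spaceTimeInit (Ns Nt : ℕ) (u0 : Fin Ns → ℝ) : Fin Nt × Fin Ns → ℝ :=
  fun p => if (p.1 : ℕ) = 0 then u0 p.2 else 0

/-- The space–time initial vector is supported on the first time block, where the transposed
system matrix acts by its diagonal block only. -/
theorem spaceTimeMat_transpose_mulVec_init (Ns Nt : ℕ) (hNt : 0 < Nt)
    (A : Matrix (Fin Ns) (Fin Ns) ℝ) (Δt : Fin Nt → ℝ) (u0 : Fin Ns → ℝ) (p : Fin Nt × Fin Ns) :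
    (spaceTimeMat Ns Nt A Δt)ᵀ.mulVec (spaceTimeInit Ns Nt u0) p =
      if p.1 = ⟨0, hNt⟩ then (1 - Δt ⟨0, hNt⟩ • Aᵀ).mulVec u0 p.2 else 0 := by
  obtain ⟨k, s⟩ := p
  have hzero : ∀ l : Fin Nt, (l : ℕ) = 0 ↔ l = ⟨0, hNt⟩ := fun l => by simp [Fin.ext_iff]
  simp only [mulVec, dotProduct, Fintype.sum_prod_type, spaceTimeInit, hzero, transpose_apply]
  rw [Finset.sum_eq_single ⟨0, hNt⟩ (fun l _ hl => by simp [hl]) (by simp)]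
  by_cases hk : k = ⟨0, hNt⟩
  · subst hk
    simp [spaceTimeMat, one_apply, eq_comm]
  · simp [spaceTimeMat, hk, Ne.symm hk]

/-- Block structure of the least-squares Petrov–Galerkin reduced space–time
initial state vector: the `j`-th block of `Φ_stᵀ (A^st)ᵀ u_0^st` equals
`D_1^j Φ_sᵀ (I − Δt^{(1)} Aᵀ) u_0`. -/
theorem petrovGalerkin_reduced_init_block (Ns Nt ns nt : ℕ) (hNt : 0 < Nt)
    (A : Matrix (Fin Ns) (Fin Ns) ℝ) (Δt : Fin Nt → ℝ) (u0 : Fin Ns → ℝ)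
    (Φs : Matrix (Fin Ns) (Fin ns) ℝ) (φt : Fin ns → Fin nt → Fin Nt → ℝ)
    (j : Fin nt) :
    (fun i : Fin ns =>
        (Phist Ns Nt ns nt Φs φt)ᵀ.mulVec
          ((spaceTimeMat Ns Nt A Δt)ᵀ.mulVec (spaceTimeInit Ns Nt u0)) (j, i)) =
      (Dmat Ns Nt ns nt φt ⟨0, hNt⟩ j).mulVec
        (Φsᵀ.mulVec ((1 - Δt ⟨0, hNt⟩ • Aᵀ).mulVec u0)) := by
  ext i
  rw [mulVec, dotProduct, Fintype.sum_prod_type]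
  simp only [spaceTimeMat_transpose_mulVec_init Ns Nt hNt]
  rw [Finset.sum_eq_single ⟨0, hNt⟩ (fun l _ hl => by simp [hl]) (by simp)]
  simp only [if_true, Phist, Dmat, transpose_apply, of_apply, mul_diagonal, mulVec_diagonal]
  rw [mulVec, dotProduct, Finset.mul_sum]
  exact Finset.sum_congr rfl fun s _ => by rw [transpose_apply]; ring
end
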